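/- arXiv:1701.04370 — 5 statements merged into one kernel-verified Lean document; each statement's English description precedes it below -/
import Mathlib

section
/- Fix Δt > 0 and c ∈ ℝ, and define λ¹_±(Δt, ε) = (Δt/(2(ε² + Δt)))·(c ± √(c² + 4ε²/Δt²)) for ε > 0. Then as ε → 0⁺, λ¹_+(Δt, ε) tends to (c + |c|)/2 and λ¹_−(Δt, ε) tends to (c − |c|)/2. In particular the characteristic speeds of the unified first-order IMEX scheme remain bounded as ε → 0 and yield the hyperbolic CFL condition Δt ≤ Δx/|c|. -/
open Filter Topology

/-- The prefactor `Δt / (2 (ε² + Δt))` tends to `1 / 2` as `ε → 0⁺`. -/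
theorem tendsto_speed_prefactor {Δt : ℝ} (hΔt : 0 < Δt) :
    Tendsto (fun ε : ℝ => Δt / (2 * (ε ^ 2 + Δt))) (𝓝[>] 0) (𝓝 (1 / 2)) := by
  have hcont : ContinuousAt (fun ε : ℝ => Δt / (2 * (ε ^ 2 + Δt))) 0 :=
    ContinuousAt.div (by fun_prop) (by fun_prop) (by positivity)
  convert hcont.tendsto.mono_left nhdsWithin_le_nhds using 2
  field_simp
  ring

/-- The square root in the characteristic speeds tends to `|c|` as `ε → 0⁺`. -/
theorem tendsto_speed_sqrt (Δt c : ℝ) :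
    Tendsto (fun ε : ℝ => Real.sqrt (c ^ 2 + 4 * ε ^ 2 / Δt ^ 2)) (𝓝[>] 0) (𝓝 |c|) := by
  have hcont : Continuous fun ε : ℝ => Real.sqrt (c ^ 2 + 4 * ε ^ 2 / Δt ^ 2) := by fun_prop
  convert (hcont.tendsto 0).mono_left nhdsWithin_le_nhds using 2
  simp [Real.sqrt_sq_eq_abs]

/-- As `ε → 0⁺`, the characteristic speeds `λ¹_±(Δt, ε)` tend to `(c ± |c|)/2`. -/
theorem stmt4 (Δt c : ℝ) (hΔt : 0 < Δt) :
    Tendsto (fun ε : ℝ =>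
        Δt / (2 * (ε ^ 2 + Δt)) * (c + Real.sqrt (c ^ 2 + 4 * ε ^ 2 / Δt ^ 2)))
      (𝓝[>] 0) (𝓝 ((c + |c|) / 2)) ∧
    Tendsto (fun ε : ℝ =>
        Δt / (2 * (ε ^ 2 + Δt)) * (c - Real.sqrt (c ^ 2 + 4 * ε ^ 2 / Δt ^ 2)))
      (𝓝[>] 0) (𝓝 ((c - |c|) / 2)) := by
  have hpre := tendsto_speed_prefactor hΔt
  have hsqrt := tendsto_speed_sqrt Δt c
  constructor
  · convert hpre.mul (hsqrt.const_add c) using 2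
    ring
  · convert hpre.mul (hsqrt.const_sub c) using 2
    ring
end

section
/- Let α ∈ [0, 1], fix Δt > 0 and c ∈ ℝ, and define λ^α_±(Δt, ε) = (Δt/(2(ε^{1+α} + Δt)))·(c ± √(c² + 4ε²/Δt²)) for ε > 0. Then as ε → 0⁺, λ^α_+(Δt, ε) tends to (c + |c|)/2 and λ^α_−(Δt, ε) tends to (c − |c|)/2; in particular the characteristic speeds of the unified first-order IMEX scheme do not diverge as ε → 0 for any value of the scaling parameter α. -/
open Filter Topology

/-- For any `α ∈ [0,1]`, as `ε → 0⁺`, the characteristic speeds `λ^α_±(Δt, ε)`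
tend to `(c ± |c|)/2`. -/
theorem stmt5 (α : ℝ) (hα : α ∈ Set.Icc (0 : ℝ) 1) (Δt c : ℝ) (hΔt : 0 < Δt) :
    Tendsto (fun ε : ℝ =>
        Δt / (2 * (ε ^ (1 + α) + Δt)) * (c + Real.sqrt (c ^ 2 + 4 * ε ^ 2 / Δt ^ 2)))
      (𝓝[>] 0) (𝓝 ((c + |c|) / 2)) ∧
    Tendsto (fun ε : ℝ =>
        Δt / (2 * (ε ^ (1 + α) + Δt)) * (c - Real.sqrt (c ^ 2 + 4 * ε ^ 2 / Δt ^ 2)))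
      (𝓝[>] 0) (𝓝 ((c - |c|) / 2)) := by
  have hexp : 0 < 1 + α := by linarith [hα.1]
  have hfactor : ContinuousAt (fun ε : ℝ => Δt / (2 * (ε ^ (1 + α) + Δt))) 0 := by
    refine continuousAt_const.div (continuousAt_const.mul
      ((Real.continuousAt_rpow_const 0 _ (Or.inr hexp.le)).add continuousAt_const)) ?_
    rw [Real.zero_rpow hexp.ne']
    positivity
  have hsqrt : ContinuousAt (fun ε : ℝ => Real.sqrt (c ^ 2 + 4 * ε ^ 2 / Δt ^ 2)) 0 := by
    fun_prop
  have hhalf : Tendsto (fun ε : ℝ => Δt / (2 * (ε ^ (1 + α) + Δt))) (𝓝[>] 0) (𝓝 (1 / 2)) := by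
    have hval : Δt / (2 * ((0 : ℝ) ^ (1 + α) + Δt)) = 1 / 2 := by
      rw [Real.zero_rpow hexp.ne', zero_add]
      field_simp
    exact hval ▸ hfactor.tendsto.mono_left nhdsWithin_le_nhds
  have habs : Tendsto (fun ε : ℝ => Real.sqrt (c ^ 2 + 4 * ε ^ 2 / Δt ^ 2)) (𝓝[>] 0)
      (𝓝 |c|) := by
    have hval : Real.sqrt (c ^ 2 + 4 * (0 : ℝ) ^ 2 / Δt ^ 2) = |c| := by
      simp [Real.sqrt_sq_eq_abs]
    exact hval ▸ hsqrt.tendsto.mono_left nhdsWithin_le_nhds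
  rw [← one_div_mul_eq_div 2 (c + |c|), ← one_div_mul_eq_div 2 (c - |c|)]
  exact ⟨hhalf.mul (habs.const_add c), hhalf.mul (habs.const_sub c)⟩
end

section
/- Let α ∈ [0, 1], fix ε > 0 and c ∈ ℝ, and define λ^α_±(Δt, ε) = (Δt/(2(ε^{1+α} + Δt)))·(c ± √(c² + 4ε²/Δt²)) for Δt > 0. Then as Δt → 0⁺, λ^α_+(Δt, ε) tends to 1/ε^α and λ^α_−(Δt, ε) tends to −1/ε^α; that is, the characteristic speeds of the modified scheme converge to the characteristic speeds ±1/ε^α of the original multiscale relaxation system. -/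
open Filter Topology

/-- The square root in the characteristic speeds, with the factor `t` absorbed. -/
theorem mul_sqrt_add_div_sq (c ε : ℝ) {t : ℝ} (ht : 0 < t) :
    t * Real.sqrt (c ^ 2 + 4 * ε ^ 2 / t ^ 2) = Real.sqrt ((c * t) ^ 2 + 4 * ε ^ 2) := by
  have h : (c * t) ^ 2 + 4 * ε ^ 2 = t ^ 2 * (c ^ 2 + 4 * ε ^ 2 / t ^ 2) := by
    field_simp
  rw [h, Real.sqrt_mul (sq_nonneg t), Real.sqrt_sq ht.le]

/-- Both characteristic speeds at once, with `s = ±1` selecting the branch. -/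
theorem tendsto_characteristicSpeed (α c s : ℝ) {ε : ℝ} (hε : 0 < ε) :
    Tendsto (fun t : ℝ =>
        t / (2 * (ε ^ (1 + α) + t)) * (c + s * Real.sqrt (c ^ 2 + 4 * ε ^ 2 / t ^ 2)))
      (𝓝[>] 0) (𝓝 (s * (1 / ε ^ α))) := by
  have hpow : ε ^ (1 + α) = ε * ε ^ α := by rw [Real.rpow_add hε, Real.rpow_one]
  have hα : 0 < ε ^ α := Real.rpow_pos_of_pos hε α
  have hsqrt : Real.sqrt (4 * ε ^ 2) = 2 * ε := by
    rw [show 4 * ε ^ 2 = (2 * ε) ^ 2 by ring, Real.sqrt_sq (by positivity)]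
  have hcont : ContinuousAt (fun t : ℝ =>
      (c * t + s * Real.sqrt ((c * t) ^ 2 + 4 * ε ^ 2)) / (2 * (ε * ε ^ α + t))) 0 := by
    refine ContinuousAt.div (by fun_prop) (by fun_prop) ?_
    rw [add_zero]
    positivity
  have hlim := hcont.tendsto.mono_left (nhdsWithin_le_nhds (s := Set.Ioi 0))
  have hval : (c * 0 + s * Real.sqrt ((c * 0) ^ 2 + 4 * ε ^ 2)) / (2 * (ε * ε ^ α + 0))
      = s * (1 / ε ^ α) := by
    rw [mul_zero, zero_pow two_ne_zero, zero_add, zero_add, add_zero, hsqrt]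
    field_simp
  rw [hval] at hlim
  refine hlim.congr' ?_
  filter_upwards [self_mem_nhdsWithin] with t ht
  rw [← mul_sqrt_add_div_sq c ε ht, hpow]
  ring

/-- For any `α ∈ [0,1]`, as `Δt → 0⁺`, the characteristic speeds `λ^α_±(Δt, ε)`
tend to `±1/ε^α`. -/
theorem stmt6 (α : ℝ) (hα : α ∈ Set.Icc (0 : ℝ) 1) (ε c : ℝ) (hε : 0 < ε) :
    Tendsto (fun Δt : ℝ =>
        Δt / (2 * (ε ^ (1 + α) + Δt)) * (c + Real.sqrt (c ^ 2 + 4 * ε ^ 2 / Δt ^ 2)))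
      (𝓝[>] 0) (𝓝 (1 / ε ^ α)) ∧
    Tendsto (fun Δt : ℝ =>
        Δt / (2 * (ε ^ (1 + α) + Δt)) * (c - Real.sqrt (c ^ 2 + 4 * ε ^ 2 / Δt ^ 2)))
      (𝓝[>] 0) (𝓝 (-(1 / ε ^ α))) := by
  exact ⟨by simpa only [one_mul] using tendsto_characteristicSpeed α c 1 hε,
    by simpa only [neg_one_mul, ← sub_eq_add_neg] using
      tendsto_characteristicSpeed α c (-1) hε⟩
end

section
/- Let s ≥ 1, let A be a real s×s matrix and b, b̃ ∈ ℝ^s, Ã a real s×s matrix, with bᵀe = 1 (consistency). Fix ε > 0 and c ∈ ℝ, and for Δt > 0 set ζ(Δt) = ε²/Δt, q(Δt) = bᵀ(ζ(Δt)I + A)⁻¹Ãe, r(Δt) = bᵀ(ζ(Δt)I + A)⁻¹e, and Λ¹_±(Δt, ε) = (1/2)·(c·q(Δt) ± √((c·q(Δt))² + 4·r(Δt)/Δt)). Then as Δt → 0⁺, Λ¹_+(Δt, ε) tends to 1/ε and Λ¹_−(Δt, ε) tends to −1/ε, i.e. the characteristic speeds of the unified IMEX Runge–Kutta scheme converge to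 the characteristic speeds ±1/ε of the original relaxation system with α = 1. -/
open Matrix Filter Topology

/-- As `t → 0`, the rescaled resolvent `t⁻¹ (a / t + A)⁻¹` tends to `a⁻¹`. -/
theorem tendsto_inv_smul_resolvent {m : Type*} [Fintype m] [DecidableEq m]
    (A : Matrix m m ℝ) {a : ℝ} (ha : a ≠ 0) :
    Tendsto (fun t : ℝ => t⁻¹ • ((a / t) • (1 : Matrix m m ℝ) + A)⁻¹) (𝓝[≠] 0)
      (𝓝 (a⁻¹ • (1 : Matrix m m ℝ))) := by
  have hcont : Continuous fun t : ℝ => a • (1 : Matrix m m ℝ) + t • A := by fun_prop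
  have hdet : Continuous fun t : ℝ => (a • (1 : Matrix m m ℝ) + t • A).det :=
    hcont.matrix_det
  have hdet0 : (a • (1 : Matrix m m ℝ) + (0 : ℝ) • A).det ≠ 0 := by
    simp [ha]
  have hinv0 : (a • (1 : Matrix m m ℝ) + (0 : ℝ) • A)⁻¹ = a⁻¹ • (1 : Matrix m m ℝ) := by
    apply inv_eq_left_inv
    simp [smul_smul, ha]
  have hlim : Tendsto (fun t : ℝ => (a • (1 : Matrix m m ℝ) + t • A)⁻¹) (𝓝[≠] 0)
      (𝓝 (a⁻¹ • (1 : Matrix m m ℝ))) := by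
    rw [← hinv0]
    simp only [inv_def, Ring.inverse_eq_inv']
    have hdet' := hdet.continuousAt.inv₀ hdet0
    exact (hdet'.smul hcont.matrix_adjugate.continuousAt).tendsto.mono_left nhdsWithin_le_nhds
  refine hlim.congr' ?_
  filter_upwards [self_mem_nhdsWithin,
    nhdsWithin_le_nhds (hdet.continuousAt.eventually_ne hdet0)] with t ht hdt
  have ht : t ≠ 0 := ht
  apply inv_eq_left_inv
  have hfac : a • (1 : Matrix m m ℝ) + t • A = t • ((a / t) • (1 : Matrix m m ℝ) + A) := by
    rw [smul_add, smul_smul, mul_div_cancel₀ _ ht]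
  have hunit : IsUnit ((a / t) • (1 : Matrix m m ℝ) + A).det := by
    rw [hfac, det_smul] at hdt
    exact (right_ne_zero_of_mul hdt).isUnit
  rw [hfac, smul_mul_smul_comm, nonsing_inv_mul _ hunit, inv_mul_cancel₀ ht, one_smul]

/-- As `t → 0`, `t⁻¹ bᵀ (a / t + A)⁻¹ v` tends to `a⁻¹ bᵀ v`. -/
theorem tendsto_dotProduct_resolvent_mulVec_div {m : Type*} [Fintype m] [DecidableEq m]
    (A : Matrix m m ℝ) (b v : m → ℝ) {a : ℝ} (ha : a ≠ 0) :
    Tendsto (fun t : ℝ => (b ⬝ᵥ (((a / t) • (1 : Matrix m m ℝ) + A)⁻¹ *ᵥ v)) / t) (𝓝[≠] 0)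
      (𝓝 (a⁻¹ * (b ⬝ᵥ v))) := by
  have hform : Continuous fun M : Matrix m m ℝ => b ⬝ᵥ (M *ᵥ v) := by fun_prop
  have h := (hform.tendsto _).comp (tendsto_inv_smul_resolvent A ha)
  simpa [Function.comp_def, smul_mulVec, dotProduct_smul, div_eq_inv_mul] using h

/-- For a consistent scheme (`bᵀe = 1`), the characteristic speeds
`Λ¹_±(Δt, ε)` of the unified IMEX-RK scheme tend to `±1/ε` as `Δt → 0⁺`. -/
theorem stmt12 {n : ℕ} (A At : Matrix (Fin (n + 1)) (Fin (n + 1)) ℝ)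
    (b bt : Fin (n + 1) → ℝ)
    (hcons : b ⬝ᵥ (fun _ => (1 : ℝ)) = 1)
    (ε c : ℝ) (hε : 0 < ε) (q r : ℝ → ℝ)
    (hq : ∀ Δt : ℝ, q Δt =
      b ⬝ᵥ (((ε ^ 2 / Δt) • (1 : Matrix (Fin (n + 1)) (Fin (n + 1)) ℝ) + A)⁻¹ *ᵥ
        (At *ᵥ fun _ => (1 : ℝ))))
    (hr : ∀ Δt : ℝ, r Δt =
      b ⬝ᵥ (((ε ^ 2 / Δt) • (1 : Matrix (Fin (n + 1)) (Fin (n + 1)) ℝ) + A)⁻¹ *ᵥ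
        fun _ => (1 : ℝ))) :
    Tendsto (fun Δt : ℝ =>
        (1 / 2) * (c * q Δt + Real.sqrt ((c * q Δt) ^ 2 + 4 * r Δt / Δt)))
      (𝓝[>] 0) (𝓝 (1 / ε)) ∧
    Tendsto (fun Δt : ℝ =>
        (1 / 2) * (c * q Δt - Real.sqrt ((c * q Δt) ^ 2 + 4 * r Δt / Δt)))
      (𝓝[>] 0) (𝓝 (-(1 / ε))) := by
  have hε2 : ε ^ 2 ≠ 0 := by positivity
  have hle : 𝓝[>] (0 : ℝ) ≤ 𝓝[≠] 0 := nhdsGT_le_nhdsNE 0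
  have hqdiv := (tendsto_dotProduct_resolvent_mulVec_div A b
    (At *ᵥ fun _ => (1 : ℝ)) hε2).mono_left hle
  have hrdiv := (tendsto_dotProduct_resolvent_mulVec_div A b
    (fun _ => (1 : ℝ)) hε2).mono_left hle
  simp only [← hq] at hqdiv
  simp only [← hr, hcons, mul_one] at hrdiv
  have hid : Tendsto (fun t : ℝ => t) (𝓝[>] 0) (𝓝 0) := tendsto_id.mono_left nhdsWithin_le_nhds
  have hq0 : Tendsto q (𝓝[>] 0) (𝓝 0) := by
    have h := hqdiv.mul hid
    rw [mul_zero] at h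
    refine h.congr' ?_
    filter_upwards [self_mem_nhdsWithin] with t ht
    exact div_mul_cancel₀ _ (ne_of_gt ht)
  have hcq : Tendsto (fun t => c * q t) (𝓝[>] 0) (𝓝 0) := by
    simpa using hq0.const_mul c
  have hsqrt : Tendsto (fun t => Real.sqrt ((c * q t) ^ 2 + 4 * r t / t)) (𝓝[>] 0)
      (𝓝 (2 / ε)) := by
    have h := ((hcq.pow 2).add (hrdiv.const_mul 4)).sqrt
    have hval : (0 : ℝ) ^ 2 + 4 * (ε ^ 2)⁻¹ = (2 / ε) ^ 2 := by
      field_simp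
      norm_num
    rw [hval, Real.sqrt_sq (by positivity)] at h
    simpa only [mul_div_assoc] using h
  constructor
  · convert (hcq.add hsqrt).const_mul (1 / 2) using 2
    ring
  · convert (hcq.sub hsqrt).const_mul (1 / 2) using 2
    ring
end

section
/- Let s ≥ 1, let A be an invertible real s×s matrix with last diagonal entry a_{ss} > 0, Ã a real s×s matrix, b, b̃ ∈ ℝ^s with bᵀ = e_sᵀA, b̃ᵀ = e_sᵀÃ (global stiff accuracy) and b̃ᵀe = 1. Fix Δt > 0 and c ∈ ℝ, and for ε > 0 set ζ(ε) = ε²/Δt, q(ε) = bᵀ(ζ(ε)I + A)⁻¹Ãe, r(ε) = bᵀ(ζ(ε)I + A)⁻¹e, and Λ¹_±(Δt, ε) = (1/2)·(c·q(ε) ± √((c·q(ε))² + 4·ζ(ε)·r(ε)/(ε² + a_{ss}Δt))). Then as ε → 0⁺, Λ¹_+(Δt, ε) tends to (c + |c|)/2 and Λ¹_−(Δt, ε) tends to (c − |c|)/2. -/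
open Matrix Filter Topology

/-- If `b` is the last row of an invertible matrix `A`, then `bᵀ(zI + A)⁻¹v` converges to the last
entry of `v` as `z → 0`. -/
theorem tendsto_dotProduct_inv_smul_one_add {n : ℕ}
    {A : Matrix (Fin (n + 1)) (Fin (n + 1)) ℝ} (hA : IsUnit A) {b : Fin (n + 1) → ℝ}
    (hb : ∀ j, b j = A (Fin.last n) j) (v : Fin (n + 1) → ℝ) {l : Filter ℝ} {z : ℝ → ℝ}
    (hz : Tendsto z l (𝓝 0)) :
    Tendsto (fun ε => b ⬝ᵥ
      ((z ε • (1 : Matrix (Fin (n + 1)) (Fin (n + 1)) ℝ) + A)⁻¹ *ᵥ v)) l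
      (𝓝 (v (Fin.last n))) := by
  have hdet : IsUnit A.det := (Matrix.isUnit_iff_isUnit_det A).mp hA
  have hM : Tendsto (fun ε => z ε • (1 : Matrix (Fin (n + 1)) (Fin (n + 1)) ℝ) + A) l (𝓝 A) := by
    simpa using (hz.smul_const (1 : Matrix (Fin (n + 1)) (Fin (n + 1)) ℝ)).add_const A
  have hinv : ContinuousAt (fun M : Matrix (Fin (n + 1)) (Fin (n + 1)) ℝ => M⁻¹) A := by
    simp only [Matrix.inv_def, Ring.inverse_eq_inv']
    exact ((continuous_id.matrix_det.continuousAt).inv₀ hdet.ne_zero).smul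
      continuous_id.matrix_adjugate.continuousAt
  have hcont : Continuous (fun M : Matrix (Fin (n + 1)) (Fin (n + 1)) ℝ => b ⬝ᵥ (M *ᵥ v)) := by
    fun_prop
  have hval : b ⬝ᵥ (A⁻¹ *ᵥ v) = v (Fin.last n) := by
    rw [show b = A (Fin.last n) from funext hb]
    change (A *ᵥ (A⁻¹ *ᵥ v)) (Fin.last n) = _
    rw [Matrix.mulVec_mulVec, Matrix.mul_nonsing_inv _ hdet, Matrix.one_mulVec]
  rw [← hval]
  exact (hcont.tendsto _).comp (hinv.tendsto.comp hM)

/-- For a GSA scheme with `b̃ᵀe = 1` and `a_{ss} > 0`, the modified characteristic speeds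
`Λ¹_±(Δt, ε) = (c·q(ε) ± √((c·q(ε))² + 4·ζ(ε)·r(ε)/(ε² + a_{ss}Δt)))/2` tend to
`(c ± |c|)/2` as `ε → 0⁺`. -/
theorem stmt13 {n : ℕ} (A At : Matrix (Fin (n + 1)) (Fin (n + 1)) ℝ) (hA : IsUnit A)
    (hass : 0 < A (Fin.last n) (Fin.last n))
    (b bt : Fin (n + 1) → ℝ)
    (hb : ∀ j, b j = A (Fin.last n) j)
    (hbt : ∀ j, bt j = At (Fin.last n) j)
    (hcons : bt ⬝ᵥ (fun _ => (1 : ℝ)) = 1)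
    (Δt c : ℝ) (hΔt : 0 < Δt) (q r : ℝ → ℝ)
    (hq : ∀ ε : ℝ, q ε =
      b ⬝ᵥ (((ε ^ 2 / Δt) • (1 : Matrix (Fin (n + 1)) (Fin (n + 1)) ℝ) + A)⁻¹ *ᵥ
        (At *ᵥ fun _ => (1 : ℝ))))
    (hr : ∀ ε : ℝ, r ε =
      b ⬝ᵥ (((ε ^ 2 / Δt) • (1 : Matrix (Fin (n + 1)) (Fin (n + 1)) ℝ) + A)⁻¹ *ᵥ
        fun _ => (1 : ℝ))) :
    Tendsto (fun ε : ℝ =>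
        (1 / 2) * (c * q ε + Real.sqrt ((c * q ε) ^ 2
          + 4 * (ε ^ 2 / Δt) * r ε / (ε ^ 2 + A (Fin.last n) (Fin.last n) * Δt))))
      (𝓝[>] 0) (𝓝 ((c + |c|) / 2)) ∧
    Tendsto (fun ε : ℝ =>
        (1 / 2) * (c * q ε - Real.sqrt ((c * q ε) ^ 2
          + 4 * (ε ^ 2 / Δt) * r ε / (ε ^ 2 + A (Fin.last n) (Fin.last n) * Δt))))
      (𝓝[>] 0) (𝓝 ((c - |c|) / 2)) := by
  have hsq : Tendsto (fun ε : ℝ => ε ^ 2) (𝓝[>] 0) (𝓝 0) := by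
    simpa using ((continuous_pow 2).tendsto (0 : ℝ)).mono_left nhdsWithin_le_nhds
  have hz : Tendsto (fun ε : ℝ => ε ^ 2 / Δt) (𝓝[>] 0) (𝓝 0) := by
    simpa using hsq.div_const Δt
  have hq1 : Tendsto q (𝓝[>] 0) (𝓝 1) := by
    have h := tendsto_dotProduct_inv_smul_one_add hA hb (At *ᵥ fun _ => (1 : ℝ)) hz
    have hlast : (At *ᵥ fun _ => (1 : ℝ)) (Fin.last n) = 1 := by
      rw [show bt = At (Fin.last n) from funext hbt] at hcons
      exact hcons
    rw [hlast] at h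
    exact h.congr fun ε => (hq ε).symm
  have hr1 : Tendsto r (𝓝[>] 0) (𝓝 1) :=
    (tendsto_dotProduct_inv_smul_one_add hA hb (fun _ => (1 : ℝ)) hz).congr
      fun ε => (hr ε).symm
  have hcq : Tendsto (fun ε => c * q ε) (𝓝[>] 0) (𝓝 c) := by
    simpa using hq1.const_mul c
  have hfrac : Tendsto (fun ε : ℝ =>
      4 * (ε ^ 2 / Δt) * r ε / (ε ^ 2 + A (Fin.last n) (Fin.last n) * Δt)) (𝓝[>] 0) (𝓝 0) := by
    have hne : 0 + A (Fin.last n) (Fin.last n) * Δt ≠ 0 := by positivity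
    simpa [Pi.div_def] using ((hz.const_mul 4).mul hr1).div (hsq.add_const _) hne
  have hsqrt : Tendsto (fun ε : ℝ => Real.sqrt ((c * q ε) ^ 2
      + 4 * (ε ^ 2 / Δt) * r ε / (ε ^ 2 + A (Fin.last n) (Fin.last n) * Δt)))
      (𝓝[>] 0) (𝓝 |c|) := by
    simpa [Real.sqrt_sq_eq_abs] using ((hcq.pow 2).add hfrac).sqrt
  constructor
  · convert (hcq.add hsqrt).const_mul (1 / 2) using 2
    ring
  · convert (hcq.sub hsqrt).const_mul (1 / 2) using 2
    ring
end
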